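/- Let G, H be primitive graphs, P : E_G × E_H → ℤ a payoff function, and let λ be a shift-invariant Borel probability measure on X_H† × X_G (with the product shift). Then the following are equivalent: (2a) λ({(x,y) ∈ X_H† × X_G : lim_{n→∞} (1/n)·Σ_{i=1}^n P(y_i, x_i) = V(G,H,P)}) = 1; (2b) ∫_{X_H† × X_G} P(y_0, x_0) dλ(x,y) = V(G,H,P); (2c) λ(Y†_{(H,G)}) = 1. -/

import Mathlib

open Filter Set

structure DirGraph (V E : Type) where
  src : E → V
  tgt : E → V

namespace DirGraph

variable {V E : Type}

/-- A (finite) walk: consecutive edges are compatible. -/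
def IsWalkList (G : DirGraph V E) (p : List E) : Prop :=
  p.Chain' fun e f => G.tgt e = G.src f

/-- The set of walks of length `n`. -/
def walks (G : DirGraph V E) (n : ℕ) : Set (List E) :=
  {p | p.length = n ∧ G.IsWalkList p}

/-- The set of walks of length `n` from `v` to `w`. -/
def walksFT (G : DirGraph V E) (n : ℕ) (v w : V) : Set (List E) :=
  {p | p.length = n ∧ G.IsWalkList p ∧
    ∃ h : p ≠ [], G.src (p.head h) = v ∧ G.tgt (p.getLast h) = w}

def IsCycle (G : DirGraph V E) (p : List E) : Prop :=
  G.IsWalkList p ∧ ∃ h : p ≠ [], G.src (p.head h) = G.tgt (p.getLast h)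

def Irreducible (G : DirGraph V E) : Prop :=
  ∀ v w : V, ∃ n : ℕ, (G.walksFT n v w).Nonempty

/-- Irreducible and the gcd of all cycle lengths is 1 (every common divisor of
the cycle lengths equals 1). -/
def Primitive (G : DirGraph V E) : Prop :=
  G.Irreducible ∧ ∀ d : ℕ, (∀ p, G.IsCycle p → d ∣ p.length) → d = 1

end DirGraph

/-- `Σ_i P(q_i, p_i)`. -/
def payoffSum {EG EH : Type} (P : EG → EH → ℤ) (q : List EG) (p : List EH) : ℤ :=
  (List.zipWith P q p).sum

/-- `V_n(G,H,P) = max_{p ∈ W_n(H)} min_{q ∈ W_n(G)} Σ P(q_i,p_i)`. -/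
noncomputable def Vn {VG EG VH EH : Type} (G : DirGraph VG EG) (H : DirGraph VH EH)
    (P : EG → EH → ℤ) (n : ℕ) : ℤ :=
  sSup ((fun p => sInf ((fun q => payoffSum P q p) '' G.walks n)) '' H.walks n)

/-- `M(p)(v,w) = inf {Σ P(q_i,p_i) : q ∈ W_n(G, v → w)}`, with `inf ∅ = ⊤`. -/
noncomputable def Mfun {VG EG EH : Type} (G : DirGraph VG EG) (P : EG → EH → ℤ)
    (p : List EH) : VG → VG → WithTop ℤ :=
  fun v w => sInf ((fun q => ((payoffSum P q p : ℤ) : WithTop ℤ)) '' G.walksFT p.length v w)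

/-- `f < g` pointwise everywhere. -/
def StrictDom {V α : Type} [LT α] (f g : V → V → α) : Prop := ∀ v w, f v w < g v w

/-- `<`-maximal elements of a set w.r.t. a strict domination relation. -/
def maxElems {α : Type} (lt : α → α → Prop) (A : Set α) : Set α :=
  {f ∈ A | ¬ ∃ g ∈ A, lt f g}

/-- Tropical convolution on `(ℤ ∪ {∞})`-valued matrices. -/
noncomputable def tconv {V : Type} (f g : V → V → WithTop ℤ) : V → V → WithTop ℤ :=
  fun u w => sInf (Set.range fun v => f u v + g v w)

/-- Tropical convolution on `ℤ`-valued matrices. -/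
noncomputable def tconvZ {V : Type} (f g : V → V → ℤ) : V → V → ℤ :=
  fun u w => sInf (Set.range fun v => f u v + g v w)

/-- Non-improvable walks in `H` (of any length). -/
noncomputable def walksDagger {VG EG VH EH : Type} (G : DirGraph VG EG) (H : DirGraph VH EH)
    (P : EG → EH → ℤ) : Set (List EH) :=
  {p | ∃ u v : VH, p ∈ H.walksFT p.length u v ∧
    Mfun G P p ∈ maxElems StrictDom (Mfun G P '' H.walksFT p.length u v)}

/-- The edge shift of a graph. -/
def XEdge {V E : Type} (G : DirGraph V E) : Set (ℤ → E) :=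
  {x | ∀ n : ℤ, G.tgt (x n) = G.src (x (n + 1))}

/-- The word `x_{[m,n]}` as a list (of length `n - m + 1` when `m ≤ n`). -/
def seg {A : Type} (x : ℤ → A) (m n : ℤ) : List A :=
  List.ofFn fun i : Fin (n + 1 - m).toNat => x (m + i)

/-- `X_H^†`: points all of whose subwords are non-improvable walks. -/
noncomputable def XHdag {VG EG VH EH : Type} (G : DirGraph VG EG) (H : DirGraph VH EH)
    (P : EG → EH → ℤ) : Set (ℤ → EH) :=
  {x | x ∈ XEdge H ∧ ∀ m n : ℤ, m ≤ n → seg x m n ∈ walksDagger G H P}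

/-- `R(p)`: optimal responses to `p`. -/
noncomputable def Rset {VG EG EH : Type} (G : DirGraph VG EG) (P : EG → EH → ℤ)
    (p : List EH) : Set (List EG) :=
  {q | ∃ v w : VG, q ∈ G.walksFT p.length v w ∧
    ((payoffSum P q p : ℤ) : WithTop ℤ) = Mfun G P p v w}

/-- The Borel (= cylinder) σ-algebra on `ℤ → E` for a discrete alphabet `E`. -/
instance cylMS (E : Type) : MeasurableSpace (ℤ → E) :=
  @MeasurableSpace.pi ℤ (fun _ => E) (fun _ => ⊤)

/-- The shift map. -/
def shiftMap {E : Type} : (ℤ → E) → (ℤ → E) := fun x n => x (n + 1)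

/-- The word `x_{[1,n]}` as a list. -/
def seg1 {A : Type} (x : ℤ → A) (n : ℕ) : List A :=
  List.ofFn fun i : Fin n => x (1 + (i : ℤ))

/-- `min M(p) = min_{v,w} M(p)(v,w) = inf over all length-`|p|` walks `q` of `G` of
`Σ P(q_i, p_i)` (computed in `ℤ`). -/
noncomputable def minM {VG EG EH : Type} (G : DirGraph VG EG) (P : EG → EH → ℤ)
    (p : List EH) : ℤ :=
  sInf ((fun q => payoffSum P q p) '' G.walks p.length)

/-- `Y†_{(H,G)}`. -/
noncomputable def Ydag {VG EG VH EH : Type} (G : DirGraph VG EG) (H : DirGraph VH EH)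
    (P : EG → EH → ℤ) : Set ((ℤ → EH) × (ℤ → EG)) :=
  {xy | xy.1 ∈ XHdag G H P ∧ xy.2 ∈ XEdge G ∧
    ∀ m n : ℤ, m ≤ n → seg xy.2 m n ∈ Rset G P (seg xy.1 m n)}

/-- The product shift. -/
def shiftMap2 {EH EG : Type} : (ℤ → EH) × (ℤ → EG) → (ℤ → EH) × (ℤ → EG) :=
  fun xy => (shiftMap xy.1, shiftMap xy.2)

namespace DirGraph

variable {V E : Type}

/-- `G.IsPath p v w`: the list of edges `p` is a possibly empty path from `v` to `w`. -/
def IsPath (G : DirGraph V E) : List E → V → V → Prop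
  | [], v, w => v = w
  | e :: p, v, w => G.src e = v ∧ IsPath G p (G.tgt e) w

theorem isPath_append {G : DirGraph V E} {p q : List E} {v w : V} :
    G.IsPath (p ++ q) v w ↔ ∃ u, G.IsPath p v u ∧ G.IsPath q u w := by
  induction p generalizing v with
  | nil => simp [IsPath]
  | cons e p ih => simp [IsPath, ih, and_assoc]

theorem isWalkList_iff {G : DirGraph V E} {p : List E} :
    G.IsWalkList p ↔ p.IsChain fun e f => G.tgt e = G.src f :=
  Iff.rfl

theorem isPath_iff {G : DirGraph V E} {p : List E} (hp : p ≠ []) {v w : V} :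
    G.IsPath p v w ↔ G.IsWalkList p ∧
      ∃ h : p ≠ [], G.src (p.head h) = v ∧ G.tgt (p.getLast h) = w := by
  induction p generalizing v with
  | nil => exact absurd rfl hp
  | cons e p ih =>
    cases p with
    | nil => simp [IsPath, isWalkList_iff]
    | cons f p =>
      have := ih (v := G.tgt e) (by simp)
      simp only [IsPath] at this ⊢
      rw [this]
      simp only [isWalkList_iff, List.isChain_cons_cons]
      simp
      grind

theorem mem_walksFT {G : DirGraph V E} {p : List E} {n : ℕ} (hn : n ≠ 0) {v w : V} :
    p ∈ G.walksFT n v w ↔ p.length = n ∧ G.IsPath p v w := by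
  constructor
  · rintro ⟨h, h'⟩
    exact ⟨h, (isPath_iff (by rintro rfl; simp_all)).2 h'⟩
  · rintro ⟨h, h'⟩
    exact ⟨h, (isPath_iff (by rintro rfl; simp_all)).1 h'⟩

theorem mem_walks {G : DirGraph V E} {p : List E} {n : ℕ} (hn : n ≠ 0) :
    p ∈ G.walks n ↔ p.length = n ∧ ∃ v w, G.IsPath p v w := by
  constructor
  · rintro ⟨h, h'⟩
    have hp : p ≠ [] := by rintro rfl; simp_all
    exact ⟨h, _, _, (isPath_iff hp).2 ⟨h', hp, rfl, rfl⟩⟩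
  · rintro ⟨h, v, w, h'⟩
    have hp : p ≠ [] := by rintro rfl; simp_all
    exact ⟨h, ((isPath_iff hp).1 h').1⟩

theorem finite_walks [Finite E] (G : DirGraph V E) (n : ℕ) : (G.walks n).Finite :=
  (List.finite_length_eq E n).subset fun _ h => h.1

theorem finite_walksFT [Finite E] (G : DirGraph V E) (n : ℕ) (v w : V) :
    (G.walksFT n v w).Finite :=
  (List.finite_length_eq E n).subset fun _ h => h.1

theorem exists_isPath_of_walksFT {G : DirGraph V E} {n : ℕ} {v w : V}
    (h : (G.walksFT n v w).Nonempty) : ∃ p : List E, p.length = n ∧ G.IsPath p v w := by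
  obtain ⟨p, h1, h2⟩ := h
  exact ⟨p, h1, (isPath_iff h2.2.1).2 h2⟩

/-- `G.Connects N`: any two vertices are joined by paths of all lengths at least `N`. -/
def Connects (G : DirGraph V E) (N : ℕ) : Prop :=
  ∀ n ≥ N, ∀ v w, ∃ p : List E, p.length = n ∧ G.IsPath p v w

theorem Primitive.exists_connects [Finite V] {G : DirGraph V E} (hG : G.Primitive) :
    ∃ N, G.Connects N := by
  have hirr : ∀ v w, ∃ p : List E, G.IsPath p v w := fun v w => by
    obtain ⟨n, hn⟩ := hG.1 v w
    obtain ⟨p, -, hp⟩ := exists_isPath_of_walksFT hn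
    exact ⟨p, hp⟩
  have hloop : ∀ v, ∃ N, ∀ n ≥ N, ∃ p : List E, p.length = n ∧ G.IsPath p v v := by
    intro v
    let S : AddSubmonoid ℕ :=
      { carrier := {n | ∃ p : List E, p.length = n ∧ G.IsPath p v v}
        zero_mem' := ⟨[], rfl, rfl⟩
        add_mem' := by
          rintro _ _ ⟨p, rfl, hp⟩ ⟨q, rfl, hq⟩
          exact ⟨p ++ q, by simp, isPath_append.2 ⟨v, hp, hq⟩⟩ }
    have hgcd : Nat.setGcd (S : Set ℕ) = 1 := by
      refine hG.2 _ ?_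
      rintro c ⟨hc, hne, hcyc⟩
      have hc' : G.IsPath c (G.src (c.head hne)) (G.src (c.head hne)) :=
        (isPath_iff hne).2 ⟨hc, hne, rfl, hcyc.symm⟩
      obtain ⟨a, ha⟩ := hirr v (G.src (c.head hne))
      obtain ⟨b, hb⟩ := hirr (G.src (c.head hne)) v
      have h1 : a.length + b.length ∈ S :=
        ⟨a ++ b, by simp, isPath_append.2 ⟨_, ha, hb⟩⟩
      have h2 : (a.length + b.length) + c.length ∈ S :=
        ⟨a ++ (c ++ b), by simp; ring, isPath_append.2 ⟨_, ha, isPath_append.2 ⟨_, hc', hb⟩⟩⟩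
      exact (Nat.dvd_add_right (Nat.setGcd_dvd_of_mem h1)).1 (Nat.setGcd_dvd_of_mem h2)
    obtain ⟨N, hN⟩ := Nat.exists_mem_closure_of_ge (S : Set ℕ)
    refine ⟨N, fun n hn => ?_⟩
    have := hN n hn (by rw [hgcd]; exact one_dvd _)
    rw [AddSubmonoid.closure_eq] at this
    exact this
  choose N hN using hloop
  choose p hp using hirr
  cases nonempty_fintype V
  refine ⟨∑ v, N v + ∑ v, ∑ w, (p v w).length, fun n hn v w => ?_⟩
  have h1 : N v ≤ ∑ v, N v := Finset.single_le_sum (fun _ _ => Nat.zero_le _) (Finset.mem_univ v)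
  have h2 : (p v w).length ≤ ∑ w, (p v w).length :=
    Finset.single_le_sum (f := fun w => (p v w).length) (fun _ _ => Nat.zero_le _)
      (Finset.mem_univ w)
  have h3 : ∑ w, (p v w).length ≤ ∑ v, ∑ w, (p v w).length :=
    Finset.single_le_sum (f := fun v => ∑ w, (p v w).length) (fun _ _ => Nat.zero_le _)
      (Finset.mem_univ v)
  obtain ⟨q, hq, hq'⟩ := hN v (n - (p v w).length) (by omega)
  exact ⟨q ++ p v w, by simp; omega, isPath_append.2 ⟨_, hq', hp v w⟩⟩

theorem Primitive.nonempty {G : DirGraph V E} (hG : G.Primitive) : Nonempty V := by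
  by_contra h
  have := hG.2 0 fun p ⟨_, hne, _⟩ => (h ⟨G.src (p.head hne)⟩).elim
  omega

end DirGraph

section payoff

variable {E F : Type}

theorem payoffSum_append (P : E → F → ℤ) {q q' : List E} {p p' : List F}
    (h : q.length = p.length) :
    payoffSum P (q ++ q') (p ++ p') = payoffSum P q p + payoffSum P q' p' := by
  simp [payoffSum, List.zipWith_append h]

theorem payoffSum_flip (P : E → F → ℤ) (q : List E) (p : List F) :
    payoffSum (flip P) p q = payoffSum P q p := by
  rw [payoffSum, payoffSum, List.zipWith_comm]
  rfl

theorem exists_forall_abs_le [Finite E] [Finite F] (P : E → F → ℤ) :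
    ∃ B : ℤ, 0 ≤ B ∧ ∀ a b, |P a b| ≤ B := by
  cases nonempty_fintype E
  cases nonempty_fintype F
  refine ⟨∑ a, ∑ b, |P a b|, by positivity, fun a b => ?_⟩
  calc |P a b| ≤ ∑ b, |P a b| :=
        Finset.single_le_sum (f := fun b => |P a b|) (fun _ _ => abs_nonneg _) (Finset.mem_univ b)
    _ ≤ _ := Finset.single_le_sum (f := fun a => ∑ b, |P a b|)
        (fun _ _ => by positivity) (Finset.mem_univ a)

theorem abs_payoffSum_le {P : E → F → ℤ} {B : ℤ} (hP : ∀ a b, |P a b| ≤ B) {q : List E}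
    {p : List F} (h : q.length = p.length) : |payoffSum P q p| ≤ q.length * B := by
  induction q generalizing p with
  | nil => simp [payoffSum]
  | cons a q ih =>
    cases p with
    | nil => simp at h
    | cons b p =>
      have h1 := ih (p := p) (by simpa using h)
      have h2 := hP a b
      simp only [payoffSum, List.zipWith_cons_cons, List.sum_cons, List.length_cons] at *
      push_cast
      rw [abs_le] at *
      constructor <;> linarith [h1.1, h1.2, h2.1, h2.2]

end payoff

section reroute

variable {V E F : Type}

/-- A long path may be rerouted to have prescribed endpoints at a bounded cost. -/
theorem DirGraph.Connects.exists_reroute {G : DirGraph V E} {N : ℕ} (hN : G.Connects N)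
    {P : E → F → ℤ} {B : ℤ} (hP : ∀ a b, |P a b| ≤ B) {q : List E} {v w : V}
    (hq : G.IsPath q v w) (hl : 2 * N ≤ q.length) (v' w' : V) :
    ∃ q', q'.length = q.length ∧ G.IsPath q' v' w' ∧
      ∀ p : List F, p.length = q.length → |payoffSum P q' p - payoffSum P q p| ≤ 4 * N * B := by
  obtain ⟨q₁, r, rfl, h1⟩ : ∃ q₁ r, q = q₁ ++ r ∧ q₁.length = N :=
    ⟨q.take N, q.drop N, by simp, by simp; omega⟩
  rw [List.length_append] at hl
  obtain ⟨q₂, q₃, rfl, h3⟩ : ∃ q₂ q₃, r = q₂ ++ q₃ ∧ q₃.length = N :=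
    ⟨r.take (r.length - N), r.drop (r.length - N), by simp, by simp; omega⟩
  obtain ⟨a, -, hq⟩ := isPath_append.1 hq
  obtain ⟨b, hq2, -⟩ := isPath_append.1 hq
  obtain ⟨q₁', hl1, hq1⟩ := hN N le_rfl v' a
  obtain ⟨q₃', hl3, hq3⟩ := hN N le_rfl b w'
  refine ⟨q₁' ++ (q₂ ++ q₃'), by simp [*], isPath_append.2 ⟨_, hq1, isPath_append.2 ⟨_, hq2, hq3⟩⟩,
    fun p hp => ?_⟩
  rw [List.length_append, List.length_append] at hp
  obtain ⟨p₁, s, rfl, k1⟩ : ∃ p₁ s, p = p₁ ++ s ∧ p₁.length = N :=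
    ⟨p.take N, p.drop N, by simp, by simp; omega⟩
  rw [List.length_append] at hp
  obtain ⟨p₂, p₃, rfl, k2⟩ : ∃ p₂ p₃, s = p₂ ++ p₃ ∧ p₂.length = q₂.length :=
    ⟨s.take q₂.length, s.drop q₂.length, by simp, by simp; omega⟩
  have k3 : p₃.length = N := by rw [List.length_append] at hp; omega
  rw [payoffSum_append P (by omega), payoffSum_append P (by omega),
    payoffSum_append P (by omega), payoffSum_append P (by omega)]
  have e1 := abs_payoffSum_le hP (q := q₁) (p := p₁) (by omega)
  have e2 := abs_payoffSum_le hP (q := q₁') (p := p₁) (by omega)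
  have e3 := abs_payoffSum_le hP (q := q₃) (p := p₃) (by omega)
  have e4 := abs_payoffSum_le hP (q := q₃') (p := p₃) (by omega)
  rw [h1] at e1
  rw [hl1] at e2
  rw [h3] at e3
  rw [hl3] at e4
  rw [abs_le] at *
  constructor <;> linarith [e1.1, e1.2, e2.1, e2.2, e3.1, e3.2, e4.1, e4.2]

end reroute

section value

variable {VG EG VH EH : Type} {G : DirGraph VG EG} {H : DirGraph VH EH} {P : EG → EH → ℤ}

theorem exists_payoffSum_le_Vn [Finite EG] [Finite EH] {n : ℕ} (hne : (G.walks n).Nonempty)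
    {p : List EH} (hp : p ∈ H.walks n) : ∃ q ∈ G.walks n, payoffSum P q p ≤ Vn G H P n := by
  obtain ⟨q, hq, hq'⟩ := (hne.image fun q => payoffSum P q p).csInf_mem
    ((G.finite_walks n).image _)
  refine ⟨q, hq, hq'.le.trans ?_⟩
  exact le_csSup ((H.finite_walks n).image _).bddAbove ⟨p, hp, rfl⟩

theorem exists_Vn_le_payoffSum [Finite EG] [Finite EH] {n : ℕ} (hne : (H.walks n).Nonempty) :
    ∃ p ∈ H.walks n, ∀ q ∈ G.walks n, Vn G H P n ≤ payoffSum P q p := by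
  obtain ⟨p, hp, hp'⟩ :=
    (hne.image fun p => sInf ((fun q => payoffSum P q p) '' G.walks n)).csSup_mem
      ((H.finite_walks n).image _)
  refine ⟨p, hp, fun q hq => (le_of_eq hp'.symm).trans ?_⟩
  exact csInf_le ((G.finite_walks n).image _).bddBelow ⟨q, hq, rfl⟩

theorem Mfun_le [Finite EG] {p : List EH} {q : List EG} {v w : VG}
    (hq : q ∈ G.walksFT p.length v w) : Mfun G P p v w ≤ (payoffSum P q p : ℤ) :=
  csInf_le (((G.finite_walksFT _ v w).image _).bddBelow) ⟨q, hq, rfl⟩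

theorem exists_payoffSum_eq_Mfun [Finite EG] {p : List EH} {v w : VG}
    (hne : (G.walksFT p.length v w).Nonempty) :
    ∃ q ∈ G.walksFT p.length v w, ((payoffSum P q p : ℤ) : WithTop ℤ) = Mfun G P p v w :=
  (hne.image fun q => ((payoffSum P q p : ℤ) : WithTop ℤ)).csInf_mem
    ((G.finite_walksFT _ v w).image _)

theorem Vn_sub_le_payoffSum [Finite EG] [Finite EH] {N : ℕ} (hG : G.Connects N)
    (hH : H.Connects N) [Nonempty VH] {B : ℤ} (hB : ∀ a b, |P a b| ≤ B) {p : List EH}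
    (hp : p ∈ walksDagger G H P) (hl : 2 * N + 1 ≤ p.length) {q : List EG}
    (hq : q ∈ G.walks p.length) : Vn G H P p.length - 8 * N * B ≤ payoffSum P q p := by
  obtain ⟨u, v, huv, -, hmax⟩ := hp
  have h0 : p.length ≠ 0 := by omega
  obtain ⟨r, hr⟩ := hH p.length (by omega) u v
  obtain ⟨s, hs, hopt⟩ := exists_Vn_le_payoffSum (G := G) (P := P) (H := H) (n := p.length)
    ⟨r, (DirGraph.mem_walks h0).2 ⟨hr.1, _, _, hr.2⟩⟩
  obtain ⟨hsl, a, b, hs⟩ := (DirGraph.mem_walks h0).1 hs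
  obtain ⟨s', hsl', hs', hdiff⟩ := hH.exists_reroute (P := flip P) (fun a b => hB b a) hs
    (by omega) u v
  rw [hsl] at hsl'
  have hdom : ¬ StrictDom (Mfun G P p) (Mfun G P s') := fun hd =>
    hmax ⟨_, ⟨s', (DirGraph.mem_walksFT h0).2 ⟨hsl', hs'⟩, rfl⟩, hd⟩
  simp only [StrictDom, not_forall, not_lt] at hdom
  obtain ⟨v₀, w₀, hle⟩ := hdom
  obtain ⟨hql, c, d, hq⟩ := (DirGraph.mem_walks h0).1 hq
  obtain ⟨q₁, hql₁, hq₁, hdiff₁⟩ := hG.exists_reroute hB hq (by omega) v₀ w₀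
  rw [hql] at hql₁
  obtain ⟨q₂, hq₂, heq⟩ := exists_payoffSum_eq_Mfun (P := P) (p := s') (v := v₀) (w := w₀)
    ⟨q₁, (DirGraph.mem_walksFT (by omega)).2 ⟨by omega, hq₁⟩⟩
  rw [← heq] at hle
  have h1 : payoffSum P q₂ s' ≤ payoffSum P q₁ p := by
    have := hle.trans (Mfun_le ((DirGraph.mem_walksFT h0).2 ⟨hql₁, hq₁⟩))
    exact_mod_cast this
  obtain ⟨hql₂, hq₂⟩ := (DirGraph.mem_walksFT (by omega)).1 hq₂
  have h2 := hopt q₂ ((DirGraph.mem_walks h0).2 ⟨by omega, _, _, hq₂⟩)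
  have h3 := hdiff q₂ (by omega)
  have h4 := hdiff₁ p (by omega)
  rw [payoffSum_flip, payoffSum_flip] at h3
  rw [abs_le] at h3 h4
  linarith [h3.1, h3.2, h4.1, h4.2]

theorem exists_isPath_payoffSum_le [Finite EG] [Finite EH] {N : ℕ} (hG : G.Connects N)
    {B : ℤ} (hB : ∀ a b, |P a b| ≤ B) {p : List EH}
    (hp : p ∈ H.walks p.length) (hl : 2 * N + 1 ≤ p.length) (v w : VG) :
    ∃ q, q.length = p.length ∧ G.IsPath q v w ∧
      payoffSum P q p ≤ Vn G H P p.length + 4 * N * B := by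
  have h0 : p.length ≠ 0 := by omega
  obtain ⟨r, hr⟩ := hG p.length (by omega) v w
  obtain ⟨s, hs, hopt⟩ := exists_payoffSum_le_Vn (G := G) (P := P)
    ⟨r, (DirGraph.mem_walks h0).2 ⟨hr.1, _, _, hr.2⟩⟩ hp
  obtain ⟨hsl, a, b, hs⟩ := (DirGraph.mem_walks h0).1 hs
  obtain ⟨s', hsl', hs', hdiff⟩ := hG.exists_reroute hB hs (by omega) v w
  have h := hdiff p (by omega)
  rw [abs_le] at h
  exact ⟨s', by omega, hs', by linarith [h.2]⟩

theorem payoffSum_le_of_mem_Rset [Finite EG] [Finite EH] {N : ℕ} (hG : G.Connects N)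
    {B : ℤ} (hB : ∀ a b, |P a b| ≤ B) {p : List EH}
    (hp : p ∈ H.walks p.length) (hl : 2 * N + 1 ≤ p.length) {q : List EG}
    (hq : q ∈ Rset G P p) : payoffSum P q p ≤ Vn G H P p.length + 4 * N * B := by
  obtain ⟨v, w, -, heq⟩ := hq
  obtain ⟨r, hrl, hr, hle⟩ := exists_isPath_payoffSum_le hG hB hp hl v w
  have h := Mfun_le (P := P) ((DirGraph.mem_walksFT (by omega)).2 ⟨hrl, hr⟩)
  rw [← heq] at h
  have h' : payoffSum P q p ≤ payoffSum P r p := by exact_mod_cast h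
  omega

theorem Vn_mul_le [Finite EG] [Finite EH] {N : ℕ} (hG : G.Connects N)
    (hH : H.Connects N) [Nonempty VG] [Nonempty VH] {B : ℤ} (hB : ∀ a b, |P a b| ≤ B) {n k : ℕ}
    (hn : 2 * N + 1 ≤ n) (hk : 1 ≤ k) :
    Vn G H P (k * n) ≤ k * (Vn G H P n + 4 * N * B) := by
  obtain ⟨v⟩ := ‹Nonempty VG›
  obtain ⟨u⟩ := ‹Nonempty VH›
  have hkn : n ≤ k * n := Nat.le_mul_of_pos_left n hk
  have h0 : k * n ≠ 0 := by omega
  have key : ∀ k : ℕ, ∀ p : List EH, p.length = k * n → (∃ a b, H.IsPath p a b) →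
      ∃ q, q.length = p.length ∧ G.IsPath q v v ∧
        payoffSum P q p ≤ k * (Vn G H P n + 4 * N * B) := by
    intro k
    induction k with
    | zero =>
      intro p hp _
      exact ⟨[], by simp [hp], rfl, by simp [payoffSum]⟩
    | succ k ih =>
      rintro p hp ⟨a, b, hab⟩
      obtain ⟨p₁, p₂, rfl, h1⟩ : ∃ p₁ p₂, p = p₁ ++ p₂ ∧ p₂.length = n :=
        ⟨p.take (k * n), p.drop (k * n), by simp, by simp [hp]; ring_nf; omega⟩
      obtain ⟨c, h3, h4⟩ := DirGraph.isPath_append.1 hab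
      obtain ⟨q₁, hl1, hq1, hle1⟩ := ih p₁ (by
        rw [List.length_append, add_mul] at hp; omega) ⟨_, _, h3⟩
      obtain ⟨q₂, hl2, hq2, hle2⟩ := exists_isPath_payoffSum_le hG hB (P := P) (H := H)
        ((DirGraph.mem_walks (p := p₂) (by omega)).2 ⟨rfl, _, _, h4⟩) (by omega) v v
      refine ⟨q₁ ++ q₂, by simp [hl1, hl2], DirGraph.isPath_append.2 ⟨_, hq1, hq2⟩, ?_⟩
      rw [payoffSum_append P hl1]
      rw [h1] at hle2
      push_cast
      linarith
  obtain ⟨r, hr⟩ := hH (k * n) (by omega) u u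
  obtain ⟨p, hp, hopt⟩ := exists_Vn_le_payoffSum (G := G) (P := P) (H := H) (n := k * n)
    ⟨r, (DirGraph.mem_walks h0).2 ⟨hr.1, _, _, hr.2⟩⟩
  obtain ⟨hpl, hp'⟩ := (DirGraph.mem_walks h0).1 hp
  obtain ⟨q, hql, hq, hle⟩ := key k p hpl hp'
  exact (hopt q ((DirGraph.mem_walks h0).2 ⟨by omega, _, _, hq⟩)).trans hle

theorem mul_value_sub_le_Vn [Finite EG] [Finite EH] {N : ℕ} (hG : G.Connects N)
    (hH : H.Connects N) [Nonempty VG] [Nonempty VH] {B : ℤ} (hB : ∀ a b, |P a b| ≤ B) {V : ℝ}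
    (hV : Tendsto (fun n : ℕ => (Vn G H P n : ℝ) / n) atTop (nhds V)) {n : ℕ}
    (hn : 2 * N + 1 ≤ n) : n * V - 4 * N * B ≤ Vn G H P n := by
  have hn0 : (0 : ℝ) < n := by exact_mod_cast (by omega : 0 < n)
  have hlim := hV.comp (tendsto_id.atTop_mul_const' (r := n) (by omega))
  have : V ≤ (Vn G H P n + 4 * N * B) / n := by
    refine le_of_tendsto hlim ?_
    filter_upwards [eventually_ge_atTop 1] with k hk
    have hk0 : (0 : ℝ) < k := by exact_mod_cast hk
    have h : (Vn G H P (k * n) : ℝ) ≤ k * (Vn G H P n + 4 * N * B) := by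
      exact_mod_cast Vn_mul_le hG hH hB hn hk
    simp only [Function.comp_apply, id]
    push_cast
    rw [div_le_div_iff₀ (by positivity) hn0]
    nlinarith
  rw [le_div_iff₀ hn0] at this
  linarith

end value

section window

variable {A : Type}

/-- The word of length `n` read off from `x` starting at position `m`. -/
def window (x : ℤ → A) (m : ℤ) (n : ℕ) : List A :=
  List.ofFn fun i : Fin n => x (m + i)

@[simp]
theorem length_window (x : ℤ → A) (m : ℤ) (n : ℕ) : (window x m n).length = n := by
  simp [window]

theorem seg_eq_window (x : ℤ → A) {m n : ℤ} {l : ℕ} (h : (n + 1 - m).toNat = l) :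
    seg x m n = window x m l := by
  subst h
  rfl

theorem window_zero (x : ℤ → A) (m : ℤ) : window x m 0 = [] := by
  simp [window]

theorem window_succ (x : ℤ → A) (m : ℤ) (n : ℕ) :
    window x m (n + 1) = x m :: window x (m + 1) n := by
  simp [window, List.ofFn_succ, add_comm, add_left_comm]

theorem window_add (x : ℤ → A) (m : ℤ) (k n : ℕ) :
    window x m (k + n) = window x m k ++ window x (m + k) n := by
  induction k generalizing m with
  | zero => simp [window_zero]
  | succ k ih =>
    rw [show k + 1 + n = (k + n) + 1 by ring, window_succ, window_succ, ih]
    simp [add_assoc, add_comm (1 : ℤ)]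

theorem window_shiftMap (x : ℤ → A) (m : ℤ) (n : ℕ) :
    window (shiftMap x) m n = window x (m + 1) n := by
  simp only [window, shiftMap]
  congr 1
  funext i
  congr 1
  ring

theorem isPath_window {V : Type} {G : DirGraph V A} {x : ℤ → A} (hx : x ∈ XEdge G) (m : ℤ)
    (n : ℕ) : G.IsPath (window x m n) (G.src (x m)) (G.src (x (m + n))) := by
  induction n generalizing m with
  | zero => simp [window_zero, DirGraph.IsPath]
  | succ n ih =>
    rw [window_succ]
    refine ⟨rfl, ?_⟩
    have := ih (m + 1)
    rw [hx m]
    convert this using 3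
    push_cast
    ring

theorem payoffSum_window {E F : Type} (P : E → F → ℤ) (y : ℤ → E) (x : ℤ → F) (m : ℤ) (n : ℕ) :
    payoffSum P (window y m n) (window x m n) = ∑ i : Fin n, P (y (m + i)) (x (m + i)) := by
  induction n generalizing m with
  | zero => simp [window_zero, payoffSum]
  | succ n ih =>
    have := ih (m + 1)
    rw [window_succ, window_succ, Fin.sum_univ_succ]
    simp only [payoffSum, List.zipWith_cons_cons, List.sum_cons] at this ⊢
    rw [this]
    simp [add_comm, add_left_comm]

end window

section points

variable {VG EG VH EH : Type} {G : DirGraph VG EG} {H : DirGraph VH EH} {P : EG → EH → ℤ}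
  {x : ℤ → EH} {y : ℤ → EG}

theorem window_mem_walksDagger (hx : x ∈ XHdag G H P) (m : ℤ) {n : ℕ} (hn : n ≠ 0) :
    window x m n ∈ walksDagger G H P := by
  rw [← seg_eq_window x (m := m) (n := m + n - 1) (by omega)]
  exact hx.2 _ _ (by omega)

theorem window_mem_walks {V A : Type} {G : DirGraph V A} {x : ℤ → A} (hx : x ∈ XEdge G) (m : ℤ)
    {n : ℕ} (hn : n ≠ 0) : window x m n ∈ G.walks n :=
  (DirGraph.mem_walks hn).2 ⟨by simp, _, _, isPath_window hx m n⟩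

theorem value_le_payoffSum [Finite EG] [Finite EH] {N : ℕ} (hG : G.Connects N)
    (hH : H.Connects N) [Nonempty VG] [Nonempty VH] {B : ℤ} (hB : ∀ a b, |P a b| ≤ B) {V : ℝ}
    (hV : Tendsto (fun n : ℕ => (Vn G H P n : ℝ) / n) atTop (nhds V)) (hx : x ∈ XHdag G H P)
    (m : ℤ) {n : ℕ} (hn : 2 * N + 1 ≤ n) {q : List EG} (hq : q ∈ G.walks n) :
    n * V - 12 * N * B ≤ payoffSum P q (window x m n) := by
  have h1 := mul_value_sub_le_Vn hG hH hB hV hn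
  have h2 := Vn_sub_le_payoffSum hG hH hB (window_mem_walksDagger hx m (n := n) (by omega))
    (by simpa using hn) (q := q) (by simpa using hq)
  rw [length_window] at h2
  have h3 : (Vn G H P n : ℝ) - 8 * N * B ≤ payoffSum P q (window x m n) := by exact_mod_cast h2
  linarith

open Classical in
/-- Replacing each suboptimal response on consecutive blocks gains at least one per such block. -/
theorem exists_improved_walk [Finite EG] (hy : y ∈ XEdge G) {L : ℕ} (hL : L ≠ 0) (K : ℕ) :
    ∃ q : List EG, q.length = K * L ∧ G.IsPath q (G.src (y 0)) (G.src (y ((K * L : ℕ) : ℤ))) ∧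
      payoffSum P q (window x 0 (K * L)) + ∑ k ∈ Finset.range K,
          (if window y ((k * L : ℕ) : ℤ) L ∈ Rset G P (window x ((k * L : ℕ) : ℤ) L) then 0 else 1)
        ≤ payoffSum P (window y 0 (K * L)) (window x 0 (K * L)) := by
  induction K with
  | zero => exact ⟨[], by simp, by simp [DirGraph.IsPath], by simp [window_zero]⟩
  | succ K ih =>
    obtain ⟨q, hql, hq, hle⟩ := ih
    set z : ℤ := ((K * L : ℕ) : ℤ) with hz
    have hpath := isPath_window hy z L
    have hz' : (((K + 1) * L : ℕ) : ℤ) = z + L := by rw [hz]; push_cast; ring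
    obtain ⟨r, hrl, hr, hle'⟩ : ∃ r : List EG, r.length = L ∧
        G.IsPath r (G.src (y z)) (G.src (y (z + L))) ∧
        payoffSum P r (window x z L) + (if window y z L ∈ Rset G P (window x z L) then 0 else 1)
          ≤ payoffSum P (window y z L) (window x z L) := by
      split_ifs with hopt
      · exact ⟨_, by simp, hpath, by simp⟩
      · have hmem : window y z L ∈
            G.walksFT (window x z L).length (G.src (y z)) (G.src (y (z + L))) :=
          (DirGraph.mem_walksFT (by simpa using hL)).2 ⟨by simp, hpath⟩
        obtain ⟨r, hr, heq⟩ := exists_payoffSum_eq_Mfun (P := P) (p := window x z L) ⟨_, hmem⟩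
        obtain ⟨hrl, hr'⟩ := (DirGraph.mem_walksFT (by simpa using hL)).1 hr
        refine ⟨r, by simpa using hrl, hr', ?_⟩
        have hlt : payoffSum P r (window x z L) < payoffSum P (window y z L) (window x z L) := by
          have := Mfun_le (P := P) hmem
          rw [← heq] at this
          refine lt_of_le_of_ne (by exact_mod_cast this) fun h => hopt ⟨_, _, hmem, ?_⟩
          rw [← h, heq]
        omega
    refine ⟨q ++ r, by simp [hql, hrl, add_mul], ?_, ?_⟩
    · rw [hz']
      exact DirGraph.isPath_append.2 ⟨_, hq, hr⟩
    · rw [Finset.sum_range_succ, add_mul, one_mul, window_add, window_add,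
        payoffSum_append P (by simpa using hql), payoffSum_append P (by simp), zero_add, ← hz]
      linarith

end points

open MeasureTheory

section measure

variable {VG EG VH EH : Type} {G : DirGraph VG EG} {H : DirGraph VH EH} {P : EG → EH → ℤ}

/-- Conditions on finitely many coordinates define measurable sets. -/
theorem measurableSet_of_coords [Finite EG] [Finite EH] {ι : Type} [Finite ι] (f : ι → ℤ)
    (T : Set (ι → EH × EG)) :
    MeasurableSet {xy : (ℤ → EH) × (ℤ → EG) | (fun i => (xy.1 (f i), xy.2 (f i))) ∈ T} := by
  let _ : MeasurableSpace EH := ⊤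
  let _ : MeasurableSpace EG := ⊤
  have hF : Measurable fun (xy : (ℤ → EH) × (ℤ → EG)) (i : ι) => (xy.1 (f i), xy.2 (f i)) :=
    measurable_pi_lambda _ fun i =>
      ((measurable_pi_apply (f i)).comp measurable_fst).prodMk
        ((measurable_pi_apply (f i)).comp measurable_snd)
  exact hF T.to_countable.measurableSet

theorem measurableSet_window [Finite EG] [Finite EH] (m : ℤ) (n : ℕ)
    (Q : List EH → List EG → Prop) :
    MeasurableSet {xy : (ℤ → EH) × (ℤ → EG) | Q (window xy.1 m n) (window xy.2 m n)} :=
  measurableSet_of_coords (fun i : Fin n => m + i)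
    {w | Q (List.ofFn fun i => (w i).1) (List.ofFn fun i => (w i).2)}

theorem measurableSet_XHdag_prod_XEdge [Finite EG] [Finite EH] :
    MeasurableSet (XHdag G H P ×ˢ XEdge G) := by
  have : XHdag G H P ×ˢ XEdge G =
      (⋂ n : ℤ, {xy : (ℤ → EH) × (ℤ → EG) | H.tgt (xy.1 n) = H.src (xy.1 (n + 1)) ∧
        G.tgt (xy.2 n) = G.src (xy.2 (n + 1))}) ∩
      ⋂ m : ℤ, ⋂ n : ℤ, {xy | m ≤ n → seg xy.1 m n ∈ walksDagger G H P} := by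
    ext xy
    simp only [XHdag, XEdge, mem_prod, mem_inter_iff, mem_iInter, mem_ofPred_eq, forall_and]
    tauto
  rw [this]
  refine .inter (.iInter fun n => ?_) (.iInter fun m => .iInter fun n => ?_)
  · exact measurableSet_of_coords (fun b : Bool => if b then n + 1 else n)
      {w | H.tgt (w false).1 = H.src (w true).1 ∧ G.tgt (w false).2 = G.src (w true).2}
  · exact measurableSet_window m (n + 1 - m).toNat fun p _ => m ≤ n → p ∈ walksDagger G H P

/-- The payoff at position `z`. -/
def payoffAt (P : EG → EH → ℤ) (z : ℤ) (xy : (ℤ → EH) × (ℤ → EG)) : ℝ :=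
  P (xy.2 z) (xy.1 z)

theorem measurable_payoffAt [Finite EG] [Finite EH] (P : EG → EH → ℤ) (z : ℤ) :
    Measurable (payoffAt P z) := fun s _ =>
  measurableSet_of_coords (fun _ : Unit => z) {w | (P (w ()).2 (w ()).1 : ℝ) ∈ s}

theorem norm_payoffAt_le {B : ℤ} (hB : ∀ a b, |P a b| ≤ B) (z : ℤ)
    (xy : (ℤ → EH) × (ℤ → EG)) : ‖payoffAt P z xy‖ ≤ B := by
  rw [Real.norm_eq_abs, payoffAt]
  exact_mod_cast hB _ _

theorem cast_payoffSum_window (xy : (ℤ → EH) × (ℤ → EG)) (m : ℤ) (n : ℕ) :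
    (payoffSum P (window xy.2 m n) (window xy.1 m n) : ℝ) =
      ∑ i : Fin n, payoffAt P (m + i) xy := by
  rw [payoffSum_window]
  simp [payoffAt]

theorem measurable_shiftMap2 [Finite EG] [Finite EH] :
    Measurable (shiftMap2 : (ℤ → EH) × (ℤ → EG) → (ℤ → EH) × (ℤ → EG)) := by
  let _ : MeasurableSpace EH := ⊤
  let _ : MeasurableSpace EG := ⊤
  exact (measurable_pi_lambda _ fun i => (measurable_pi_apply (i + 1)).comp measurable_fst).prodMk
    (measurable_pi_lambda _ fun i => (measurable_pi_apply (i + 1)).comp measurable_snd)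

theorem eq_of_forall_add_one {α : Type*} {φ : ℤ → α} (h : ∀ z, φ (z + 1) = φ z) (z : ℤ) :
    φ z = φ 0 := by
  induction z using Int.induction_on with
  | zero => rfl
  | succ i ih => rw [h, ih]
  | pred i ih => rw [← ih, ← h (-i - 1), sub_add_cancel]

variable {lam : Measure ((ℤ → EH) × (ℤ → EG))}

theorem integrable_payoffAt [Finite EG] [Finite EH] [IsProbabilityMeasure lam] (P : EG → EH → ℤ)
    (z : ℤ) : Integrable (payoffAt P z) lam := by
  obtain ⟨B, -, hB⟩ := exists_forall_abs_le P
  exact .of_bound (measurable_payoffAt P z).aestronglyMeasurable B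
    (.of_forall (norm_payoffAt_le hB z))

theorem integral_payoffAt [Finite EG] [Finite EH] (hlam : MeasurePreserving shiftMap2 lam lam)
    (z : ℤ) : ∫ xy, payoffAt P z xy ∂lam = ∫ xy, payoffAt P 0 xy ∂lam := by
  refine eq_of_forall_add_one (φ := fun z => ∫ xy, payoffAt P z xy ∂lam) (fun z => ?_) z
  conv_rhs => rw [← hlam.map_eq]
  rw [integral_map hlam.aemeasurable (measurable_payoffAt P z).aestronglyMeasurable]
  rfl

theorem integral_payoffSum_window [Finite EG] [Finite EH] [IsProbabilityMeasure lam]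
    (hlam : MeasurePreserving shiftMap2 lam lam) (m : ℤ) (n : ℕ) :
    ∫ xy, (payoffSum P (window xy.2 m n) (window xy.1 m n) : ℝ) ∂lam =
      n * ∫ xy, payoffAt P 0 xy ∂lam := by
  simp_rw [cast_payoffSum_window]
  rw [integral_finsetSum _ fun i _ => integrable_payoffAt P _]
  simp_rw [integral_payoffAt hlam]
  simp

/-- The set of pairs whose response on the block of length `L` at position `z` is suboptimal. -/
def badSet (G : DirGraph VG EG) (P : EG → EH → ℤ) (L : ℕ) (z : ℤ) :
    Set ((ℤ → EH) × (ℤ → EG)) :=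
  {xy | window xy.2 z L ∉ Rset G P (window xy.1 z L)}

theorem measurableSet_badSet [Finite EG] [Finite EH] (L : ℕ) (z : ℤ) :
    MeasurableSet (badSet G P L z) :=
  measurableSet_window z L fun p q => q ∉ Rset G P p

theorem measureReal_badSet [Finite EG] [Finite EH] (hlam : MeasurePreserving shiftMap2 lam lam)
    (L : ℕ) (z : ℤ) : lam.real (badSet G P L z) = lam.real (badSet G P L 0) := by
  refine eq_of_forall_add_one (φ := fun z => lam.real (badSet G P L z)) (fun z => ?_) z
  have : badSet G P L (z + 1) = shiftMap2 ⁻¹' badSet G P L z := by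
    ext xy
    simp [badSet, shiftMap2, window_shiftMap]
  rw [this, hlam.measureReal_preimage (measurableSet_badSet L z).nullMeasurableSet]

theorem measureReal_badSet_eq_zero [Finite EG] [Finite EH] [IsProbabilityMeasure lam] {N : ℕ}
    (hG : G.Connects N) (hH : H.Connects N) [Nonempty VG] [Nonempty VH] {V : ℝ}
    (hV : Tendsto (fun n : ℕ => (Vn G H P n : ℝ) / n) atTop (nhds V))
    (hlam : MeasurePreserving shiftMap2 lam lam)
    (hX : ∀ᵐ xy ∂lam, xy ∈ XHdag G H P ×ˢ XEdge G)
    (hint : ∫ xy, payoffAt P 0 xy ∂lam = V) {L : ℕ} (hL : L ≠ 0) (z : ℤ) :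
    lam.real (badSet G P L z) = 0 := by
  classical
  obtain ⟨B, -, hB⟩ := exists_forall_abs_le P
  rw [measureReal_badSet hlam]
  set a := lam.real (badSet G P L 0)
  have key : ∀ K : ℕ, 2 * N + 1 ≤ K → K * a ≤ 12 * N * B := by
    intro K hK
    have hKL : K ≤ K * L := Nat.le_mul_of_pos_right K (by omega)
    have hi : ∀ k : ℕ, Integrable
        ((badSet G P L ((k * L : ℕ) : ℤ)).indicator fun _ => (1 : ℝ)) lam := fun k =>
      (integrable_const 1).indicator (measurableSet_badSet _ _)
    have hI : Integrable (fun xy => ∑ k ∈ Finset.range K,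
        (badSet G P L ((k * L : ℕ) : ℤ)).indicator (fun _ => (1 : ℝ)) xy) lam :=
      integrable_finsetSum _ fun k _ => hi k
    have hS : Integrable (fun xy : (ℤ → EH) × (ℤ → EG) =>
        (payoffSum P (window xy.2 0 (K * L)) (window xy.1 0 (K * L)) : ℝ)) lam := by
      simp_rw [cast_payoffSum_window]
      exact integrable_finsetSum _ fun i _ => integrable_payoffAt P _
    have hle : ∫ xy, (((K * L : ℕ) : ℝ) * V - 12 * N * B) + ∑ k ∈ Finset.range K,
        (badSet G P L ((k * L : ℕ) : ℤ)).indicator (fun _ => (1 : ℝ)) xy ∂lam ≤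
        ∫ xy, (payoffSum P (window xy.2 0 (K * L)) (window xy.1 0 (K * L)) : ℝ) ∂lam := by
      refine integral_mono_ae ((integrable_const _).add hI) hS ?_
      filter_upwards [hX] with xy hxy
      obtain ⟨q, hql, hq, hgain⟩ :=
        exists_improved_walk (P := P) (x := xy.1) hxy.2 hL K
      have h1 := value_le_payoffSum hG hH hB hV hxy.1 0 (n := K * L) (by omega)
        ((DirGraph.mem_walks (by omega)).2 ⟨hql, _, _, hq⟩)
      have h2 : ∑ k ∈ Finset.range K,
          (badSet G P L ((k * L : ℕ) : ℤ)).indicator (fun _ => (1 : ℝ)) xy =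
          ((∑ k ∈ Finset.range K, if window xy.2 ((k * L : ℕ) : ℤ) L ∈
            Rset G P (window xy.1 ((k * L : ℕ) : ℤ) L) then 0 else 1 : ℤ) : ℝ) := by
        push_cast
        refine Finset.sum_congr rfl fun k _ => ?_
        simp only [indicator, badSet, mem_ofPred_eq]
        split_ifs <;> simp_all
      have h3 := (Int.cast_le (R := ℝ)).2 hgain
      rw [Int.cast_add, ← h2] at h3
      linarith
    rw [integral_add (integrable_const _) hI, integral_payoffSum_window hlam, hint,
      integral_finsetSum _ fun k _ => hi k] at hle
    simp_rw [integral_indicator_const _ (measurableSet_badSet _ _), measureReal_badSet hlam] at hle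
    simp only [integral_const, probReal_univ, Finset.sum_const, Finset.card_range,
      nsmul_eq_mul, smul_eq_mul, mul_one] at hle
    linarith
  by_contra hne
  have hpos : 0 < a := lt_of_le_of_ne measureReal_nonneg (Ne.symm hne)
  obtain ⟨K, hK⟩ := exists_nat_gt (12 * N * B / a)
  rw [div_lt_iff₀ hpos] at hK
  have := key (K + (2 * N + 1)) (by omega)
  push_cast at this
  have h0 : 0 ≤ (2 * (N : ℝ) + 1) * a := by positivity
  linarith

theorem tendsto_payoff_of_mem_Ydag [Finite EG] [Finite EH] {N : ℕ}
    (hG : G.Connects N) (hH : H.Connects N) [Nonempty VG] [Nonempty VH] {V : ℝ}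
    (hV : Tendsto (fun n : ℕ => (Vn G H P n : ℝ) / n) atTop (nhds V))
    {xy : (ℤ → EH) × (ℤ → EG)} (hxy : xy ∈ Ydag G H P) :
    Tendsto (fun n : ℕ => (payoffSum P (window xy.2 1 n) (window xy.1 1 n) : ℝ) / n)
      atTop (nhds V) := by
  obtain ⟨B, -, hB⟩ := exists_forall_abs_le P
  have hlow : Tendsto (fun n : ℕ => V - (12 * N * B : ℝ) / n) atTop (nhds V) := by
    simpa using tendsto_const_nhds.sub (tendsto_const_div_atTop_nhds_zero_nat (12 * N * B : ℝ))
  have hup : Tendsto (fun n : ℕ => (Vn G H P n : ℝ) / n + (4 * N * B : ℝ) / n) atTop (nhds V) := by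
    simpa using hV.add (tendsto_const_div_atTop_nhds_zero_nat (4 * N * B : ℝ))
  refine tendsto_of_tendsto_of_tendsto_of_le_of_le' hlow hup ?_ ?_
  · filter_upwards [eventually_ge_atTop (2 * N + 1)] with n hn
    have hn0 : (0 : ℝ) < n := by exact_mod_cast (by omega : 0 < n)
    have := value_le_payoffSum hG hH hB hV hxy.1 1 hn
      (window_mem_walks hxy.2.1 1 (n := n) (by omega))
    rw [le_div_iff₀ hn0, sub_mul, div_mul_cancel₀ _ hn0.ne']
    linarith
  · filter_upwards [eventually_ge_atTop (2 * N + 1)] with n hn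
    have hn0 : (0 : ℝ) < n := by exact_mod_cast (by omega : 0 < n)
    rw [← add_div]
    refine div_le_div_of_nonneg_right ?_ hn0.le
    have hR : window xy.2 1 n ∈ Rset G P (window xy.1 1 n) := by
      rw [← seg_eq_window xy.1 (m := 1) (n := n) (by omega),
        ← seg_eq_window xy.2 (m := 1) (n := n) (by omega)]
      exact hxy.2.2 _ _ (by omega)
    have := payoffSum_le_of_mem_Rset (H := H) hG hB
      (by simpa using window_mem_walks hxy.1.1 1 (n := n) (by omega)) (by simpa using hn) hR
    rw [length_window] at this
    exact_mod_cast this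

theorem integral_payoffAt_eq_of_tendsto [Finite EG] [Finite EH] [IsProbabilityMeasure lam]
    {V : ℝ} (hlam : MeasurePreserving shiftMap2 lam lam)
    (h : ∀ᵐ xy ∂lam, Tendsto
      (fun n : ℕ => (payoffSum P (window xy.2 1 n) (window xy.1 1 n) : ℝ) / n) atTop (nhds V)) :
    ∫ xy, payoffAt P 0 xy ∂lam = V := by
  obtain ⟨B, hB0, hB⟩ := exists_forall_abs_le P
  have hlim := tendsto_integral_of_dominated_convergence (μ := lam) (fun _ => (B : ℝ))
    (F := fun (n : ℕ) xy => (payoffSum P (window xy.2 1 n) (window xy.1 1 n) : ℝ) / n)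
    (f := fun _ => V) (fun n => by
      simp_rw [cast_payoffSum_window]
      exact ((Finset.measurable_fun_sum _ fun i _ =>
        measurable_payoffAt P _).div_const _).aestronglyMeasurable)
    (integrable_const _) (fun n => .of_forall fun xy => by
      rw [norm_div, Real.norm_natCast]
      refine div_le_of_le_mul₀ (by positivity) (by exact_mod_cast hB0) ?_
      have := abs_payoffSum_le hB (q := window xy.2 1 n) (p := window xy.1 1 n) (by simp)
      rw [length_window] at this
      rw [Real.norm_eq_abs, mul_comm]
      exact_mod_cast this) h
  rw [integral_const, probReal_univ, one_smul] at hlim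
  refine tendsto_nhds_unique (tendsto_const_nhds.congr' ?_) hlim
  filter_upwards [eventually_ge_atTop 1] with n hn
  have hn0 : (n : ℝ) ≠ 0 := by exact_mod_cast (by omega : n ≠ 0)
  rw [integral_div, integral_payoffSum_window hlam]
  field_simp

theorem measure_eq_one_iff_ae [IsProbabilityMeasure lam] {S : Set ((ℤ → EH) × (ℤ → EG))}
    (hS : MeasurableSet S) : lam S = 1 ↔ ∀ᵐ xy ∂lam, xy ∈ S := by
  rw [← prob_compl_eq_zero_iff hS, mem_ae_iff.symm]
  rfl

end measure

open MeasureTheory in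
/-- Equivalent characterizations of measures supported on optimal strategy pairs:
(2a) ↔ (2c) and (2b) ↔ (2c). -/
theorem optimizing_measures_pairs {VG EG VH EH : Type} [Fintype VG] [Fintype EG]
    [Fintype VH] [Fintype EH] (G : DirGraph VG EG) (H : DirGraph VH EH)
    (hG : G.Primitive) (hH : H.Primitive) (P : EG → EH → ℤ) (V : ℝ)
    (hV : Filter.Tendsto (fun n : ℕ => (Vn G H P n : ℝ) / n) Filter.atTop (nhds V))
    (lam : Measure ((ℤ → EH) × (ℤ → EG))) (hprob : IsProbabilityMeasure lam)
    (hsupp : lam (XHdag G H P ×ˢ XEdge G) = 1)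
    (hinv : ∀ A : Set ((ℤ → EH) × (ℤ → EG)), MeasurableSet A →
      lam (shiftMap2 ⁻¹' A) = lam A) :
    ((lam {xy | xy ∈ XHdag G H P ×ˢ XEdge G ∧ Filter.Tendsto
          (fun n : ℕ =>
            ((∑ i : Fin n, P (xy.2 (1 + (i : ℤ))) (xy.1 (1 + (i : ℤ))) : ℤ) : ℝ) / n)
          Filter.atTop (nhds V)} = 1)
      ↔ lam (Ydag G H P) = 1)
    ∧ ((∫ xy in XHdag G H P ×ˢ XEdge G, (P (xy.2 0) (xy.1 0) : ℝ) ∂lam = V)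
      ↔ lam (Ydag G H P) = 1) := by
  have hGne := hG.nonempty
  have hHne := hH.nonempty
  obtain ⟨N₁, hN₁⟩ := hG.exists_connects
  obtain ⟨N₂, hN₂⟩ := hH.exists_connects
  have hGc : G.Connects (max N₁ N₂) := fun n hn => hN₁ n ((le_max_left _ _).trans hn)
  have hHc : H.Connects (max N₁ N₂) := fun n hn => hN₂ n ((le_max_right _ _).trans hn)
  have hlam : MeasurePreserving shiftMap2 lam lam :=
    ⟨measurable_shiftMap2, Measure.ext fun A hA => by
      rw [Measure.map_apply measurable_shiftMap2 hA, hinv A hA]⟩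
  have hX := (measure_eq_one_iff_ae measurableSet_XHdag_prod_XEdge).1 hsupp
  have hint : ∫ xy in XHdag G H P ×ˢ XEdge G, (P (xy.2 0) (xy.1 0) : ℝ) ∂lam =
      ∫ xy, payoffAt P 0 xy ∂lam := by
    rw [Measure.restrict_eq_self_of_ae_mem hX]
    rfl
  rw [hint]
  simp_rw [← payoffSum_window]
  have hac : lam {xy | xy ∈ XHdag G H P ×ˢ XEdge G ∧ Tendsto (fun n : ℕ =>
      (payoffSum P (window xy.2 1 n) (window xy.1 1 n) : ℝ) / n) atTop (nhds V)} = 1 →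
      ∫ xy, payoffAt P 0 xy ∂lam = V := by
    intro h
    refine integral_payoffAt_eq_of_tendsto hlam ?_
    rw [measure_eq_one_iff_ae] at h
    · exact h.mono fun xy hxy => hxy.2
    · refine measurableSet_XHdag_prod_XEdge.inter (measurableSet_tendsto _ fun n => ?_)
      simp_rw [cast_payoffSum_window]
      exact (Finset.measurable_fun_sum _ fun i _ => measurable_payoffAt P _).div_const _
  have hbc : ∫ xy, payoffAt P 0 xy ∂lam = V → lam (Ydag G H P) = 1 := by
    intro h
    have hopt : ∀ᵐ xy ∂lam, ∀ (z : ℤ) (L : ℕ), L ≠ 0 → xy ∉ badSet G P L z := by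
      simp_rw [ae_all_iff]
      intro z L hL
      have := measureReal_badSet_eq_zero hGc hHc hV hlam hX h hL z
      rw [measureReal_eq_zero_iff] at this
      exact measure_eq_zero_iff_ae_notMem.1 this
    refine (measure_eq_measure_of_null_sdiff (subset_univ _) ?_).trans measure_univ
    rw [← compl_eq_univ_sdiff]
    refine mem_ae_iff.1 ?_
    filter_upwards [hX, hopt] with xy hxy hgood
    refine ⟨hxy.1, hxy.2, fun m n hmn => ?_⟩
    exact not_not.1 (hgood m (n + 1 - m).toNat (by omega))
  have hca : lam (Ydag G H P) = 1 → lam {xy | xy ∈ XHdag G H P ×ˢ XEdge G ∧ Tendsto (fun n : ℕ =>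
      (payoffSum P (window xy.2 1 n) (window xy.1 1 n) : ℝ) / n) atTop (nhds V)} = 1 := by
    intro h
    refine le_antisymm prob_le_one (h.symm.le.trans (measure_mono fun xy hxy => ?_))
    exact ⟨⟨hxy.1, hxy.2.1⟩, tendsto_payoff_of_mem_Ydag hGc hHc hV hxy⟩
  exact ⟨⟨fun h => hbc (hac h), hca⟩, ⟨hbc, fun h => hac (hca h)⟩⟩
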